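/- Let S ⊆ ℂ be a finite set of n points, let K ≥ 4 be an integer, and let M be the number of 3-element subsets of S that form an isosceles triangle. For each integer i, let κ_i denote the number of subsets V ⊆ S that are vertex sets of regular i-gons. Then Σ_{i=K}^{n} i·φ(i)·κ_i ≤ 2M, where φ is Euler's totient function. -/

import Mathlib

/-- `V` is the vertex set of a regular `k`-gon: there are `c z : ℂ` with `z ≠ 0`
such that `V = { c + z·exp(2πi·j/k) : j = 0, 1, …, k-1 }`. -/
def IsRegularGonVertexSet (k : ℕ) (V : Finset ℂ) : Prop :=
  ∃ c z : ℂ, z ≠ 0 ∧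
    (V : Set ℂ) = {x : ℂ | ∃ j : ℕ, j < k ∧
      x = c + z * Complex.exp (2 * Real.pi * Complex.I * j / k)}

/-- A regular `k`-gon consists of the points `c + z * ζ` with `ζ ^ k = 1`. -/
theorem IsRegularGonVertexSet.exists_mem_iff {k : ℕ} {V : Finset ℂ} (hk : 0 < k)
    (h : IsRegularGonVertexSet k V) :
    ∃ c z : ℂ, z ≠ 0 ∧ ∀ x, x ∈ V ↔ ∃ ζ : ℂ, ζ ^ k = 1 ∧ x = c + z * ζ := by
  obtain ⟨c, z, hz, hV⟩ := h
  refine ⟨c, z, hz, fun x => ?_⟩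
  have : NeZero k := ⟨hk.ne'⟩
  have hprim := Complex.isPrimitiveRoot_exp k hk.ne'
  have hpow (j : ℕ) : Complex.exp (2 * Real.pi * Complex.I * j / k) =
      Complex.exp (2 * Real.pi * Complex.I / k) ^ j := by
    rw [← Complex.exp_nat_mul]
    congr 1
    ring
  rw [← Finset.mem_coe, hV, Set.mem_ofPred_eq]
  constructor
  · rintro ⟨j, -, rfl⟩
    exact ⟨_, by rw [hpow, pow_right_comm, hprim.pow_eq_one, one_pow], rfl⟩
  · rintro ⟨ζ, hζ, rfl⟩
    obtain ⟨j, hj, rfl⟩ := hprim.eq_pow_of_pow_eq_one hζ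
    exact ⟨j, hj, by rw [hpow]⟩

theorem IsRegularGonVertexSet.card_eq {k : ℕ} {V : Finset ℂ} (hk : 0 < k)
    (h : IsRegularGonVertexSet k V) : V.card = k := by
  classical
  obtain ⟨c, z, hz, hV⟩ := h.exists_mem_iff hk
  have hVimage : V = (Polynomial.nthRootsFinset k (1 : ℂ)).image (fun ζ => c + z * ζ) := by
    ext x
    simp only [hV, Finset.mem_image, Polynomial.mem_nthRootsFinset hk, eq_comm]
  rw [hVimage, Finset.card_image_of_injective _
    (fun a b hab => mul_left_cancel₀ hz (add_left_cancel hab)),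
    (Complex.isPrimitiveRoot_exp k hk.ne').card_nthRootsFinset]

/-- A regular `k`-gon has a center around which it is the orbit of each of its vertices
under the `k`-th roots of unity. -/
theorem IsRegularGonVertexSet.exists_center {k : ℕ} {V : Finset ℂ} (hk : 0 < k)
    (h : IsRegularGonVertexSet k V) :
    ∃ c : ℂ, ∀ p ∈ V, p ≠ c ∧ ∀ x, x ∈ V ↔ ∃ ζ : ℂ, ζ ^ k = 1 ∧ x = c + (p - c) * ζ := by
  obtain ⟨c, z, hz, hV⟩ := h.exists_mem_iff hk
  refine ⟨c, fun p hp => ?_⟩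
  obtain ⟨η, hη, rfl⟩ := (hV p).1 hp
  have hη0 : η ≠ 0 := by
    rintro rfl
    simp [hk.ne'] at hη
  refine ⟨by simp [hz, hη0], fun x => (hV x).trans ⟨?_, ?_⟩⟩
  · rintro ⟨ζ, hζ, rfl⟩
    exact ⟨ζ / η, by rw [div_pow, hζ, hη, div_one], by field_simp; ring⟩
  · rintro ⟨ζ, hζ, rfl⟩
    exact ⟨η * ζ, by rw [mul_pow, hζ, hη, one_mul], by ring⟩

open scoped Classical in
/-- The triangle with apex `p` whose other vertices are the rotations of `p` about `c`
by `u` and `u⁻¹`. -/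
noncomputable def rotationTriangle (c p u : ℂ) : Finset ℂ :=
  {p, c + (p - c) * u, c + (p - c) * u⁻¹}

theorem mem_rotationTriangle {c p u x : ℂ} :
    x ∈ rotationTriangle c p u ↔
      x = p ∨ x = c + (p - c) * u ∨ x = c + (p - c) * u⁻¹ := by
  simp [rotationTriangle]

theorem apex_ne_rotation {c p u : ℂ} (hp : p ≠ c) (hu : u ≠ 1) : p ≠ c + (p - c) * u := by
  intro h
  have : (p - c) * (u - 1) = 0 := by linear_combination -h
  simp [sub_eq_zero, hp, hu] at this

theorem rotation_ne_rotation_inv {c p u : ℂ} (hp : p ≠ c) (hu : u ≠ 0) (hu2 : u ^ 2 ≠ 1) :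
    c + (p - c) * u ≠ c + (p - c) * u⁻¹ := by
  intro h
  have h' := mul_left_cancel₀ (sub_ne_zero.2 hp) (add_left_cancel h)
  apply hu2
  field_simp at h'
  exact h'

theorem dist_center_of_mem_rotationTriangle {c p u x : ℂ} (hu : ‖u‖ = 1)
    (hx : x ∈ rotationTriangle c p u) : dist x c = dist p c := by
  rcases mem_rotationTriangle.1 hx with rfl | rfl | rfl <;> simp [dist_eq_norm, hu]

theorem center_eq_of_rotationTriangle_eq {c p u c' p' u' : ℂ} (hp : p ≠ c)
    (hu : ‖u‖ = 1) (hu1 : u ≠ 1) (hu2 : u ^ 2 ≠ 1) (hu' : ‖u'‖ = 1)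
    (h : rotationTriangle c p u = rotationTriangle c' p' u') : c = c' := by
  by_contra hc
  have hu0 : u ≠ 0 := by
    rintro rfl
    simp at hu
  have h0 : p ∈ rotationTriangle c p u := mem_rotationTriangle.2 (.inl rfl)
  have h1 : c + (p - c) * u ∈ rotationTriangle c p u := mem_rotationTriangle.2 (.inr (.inl rfl))
  have h2 : c + (p - c) * u⁻¹ ∈ rotationTriangle c p u :=
    mem_rotationTriangle.2 (.inr (.inr rfl))
  have hd {x : ℂ} (hx : x ∈ rotationTriangle c p u) :=
    dist_center_of_mem_rotationTriangle hu hx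
  have hd' {x : ℂ} (hx : x ∈ rotationTriangle c p u) :=
    dist_center_of_mem_rotationTriangle hu' (h ▸ hx)
  rcases EuclideanGeometry.eq_of_dist_eq_of_dist_eq_of_finrank_eq_two Complex.finrank_real_complex
    hc (apex_ne_rotation hp hu1) (hd h0) (hd h1) (hd h2) (hd' h0) (hd' h1) (hd' h2) with h3 | h3
  · exact apex_ne_rotation hp (inv_ne_one.2 hu1) h3.symm
  · exact rotation_ne_rotation_inv hp hu0 hu2 h3.symm

/-- A non-equilateral rotation triangle determines its apex, and its angle up to orientation. -/
theorem apex_eq_of_rotationTriangle_eq {c p u p' u' : ℂ} (hp : p ≠ c) (hp' : p' ≠ c)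
    (hu0 : u ≠ 0) (hu1 : u ≠ 1) (hu2 : u ^ 2 ≠ 1) (hu3 : u ^ 3 ≠ 1) (hu1' : u' ≠ 1)
    (h : rotationTriangle c p u = rotationTriangle c p' u') :
    p' = p ∧ (u' = u ∨ u' = u⁻¹) := by
  have key (v : ℂ) (hv0 : v ≠ 0) (hv1 : v ≠ 1) (hv2 : v ^ 2 ≠ 1) (hv3 : v ^ 3 ≠ 1)
      (hv : rotationTriangle c p v = rotationTriangle c p' u') : p' ≠ c + (p - c) * v := by
    intro hpv
    have hpc : p' - c = (p - c) * v := by rw [hpv]; ring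
    have hsub := sub_ne_zero.2 hp
    have hsquare : c + (p - c) * v ^ 2 ∈ rotationTriangle c p' u' := by
      have hmem : p ∈ rotationTriangle c p' u' := hv ▸ mem_rotationTriangle.2 (.inl rfl)
      rw [mem_rotationTriangle, hpc] at hmem ⊢
      rcases hmem with hmem | hmem | hmem
      · exact absurd (hmem.trans hpv) (apex_ne_rotation hp hv1)
      · have : v * u' = 1 := mul_left_cancel₀ hsub (by linear_combination -hmem)
        rw [eq_inv_of_mul_eq_one_right this, inv_inv]
        right; right; ring
      · have : v * u'⁻¹ = 1 := mul_left_cancel₀ hsub (by linear_combination -hmem)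
        rw [inv_injective (eq_inv_of_mul_eq_one_right this)]
        right; left; ring
    rw [← hv, mem_rotationTriangle] at hsquare
    rcases hsquare with hs | hs | hs
    · exact hv2 (mul_left_cancel₀ hsub (by linear_combination hs))
    · have : v ^ 2 = v := mul_left_cancel₀ hsub (by linear_combination hs)
      exact hv1 (mul_left_cancel₀ hv0 (by linear_combination this))
    · have : v ^ 2 = v⁻¹ := mul_left_cancel₀ hsub (by linear_combination hs)
      exact hv3 (by rw [pow_succ, this, inv_mul_cancel₀ hv0])
  have hinv : rotationTriangle c p u⁻¹ = rotationTriangle c p' u' := by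
    rw [← h]
    ext x
    simp only [mem_rotationTriangle, inv_inv]
    tauto
  have hpp : p' = p := by
    have hmem : p' ∈ rotationTriangle c p u := h ▸ mem_rotationTriangle.2 (.inl rfl)
    rcases mem_rotationTriangle.1 hmem with hmem | hmem | hmem
    · exact hmem
    · exact absurd hmem (key u hu0 hu1 hu2 hu3 h)
    · exact absurd hmem (key u⁻¹ (inv_ne_zero hu0) (inv_ne_one.2 hu1)
        (by rwa [inv_pow, inv_ne_one]) (by rwa [inv_pow, inv_ne_one]) hinv)
  subst hpp
  refine ⟨rfl, ?_⟩
  have hmem : c + (p' - c) * u' ∈ rotationTriangle c p' u :=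
    h ▸ mem_rotationTriangle.2 (.inr (.inl rfl))
  rcases mem_rotationTriangle.1 hmem with hmem | hmem | hmem
  · exact absurd hmem.symm (apex_ne_rotation hp' hu1')
  · exact .inl (mul_left_cancel₀ (sub_ne_zero.2 hp) (add_left_cancel hmem))
  · exact .inr (mul_left_cancel₀ (sub_ne_zero.2 hp) (add_left_cancel hmem))

open scoped Classical in
/-- Let `S` be a set of `n` points, `K ≥ 4`, `M` the number of 3-element subsets
of `S` forming an isosceles triangle, and `κ_i` the number of subsets of `S` that
are vertex sets of regular `i`-gons.  Then `Σ_{i=K}^{n} i·φ(i)·κ_i ≤ 2M`. -/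
theorem stmt_11 (S : Finset ℂ) (K : ℕ) (hK : 4 ≤ K) :
    ∑ i ∈ Finset.Icc K S.card,
        i * Nat.totient i * (S.powerset.filter (fun V => IsRegularGonVertexSet i V)).card
      ≤ 2 * (S.powerset.filter (fun t => t.card = 3 ∧
          ∃ p ∈ t, ∃ q ∈ t, ∃ r ∈ t, p ≠ q ∧ p ≠ r ∧ q ≠ r ∧
            ‖p - q‖ = ‖p - r‖)).card := by
  have hcenter (i : ℕ) (V : Finset ℂ) : ∃ c : ℂ, 0 < i → IsRegularGonVertexSet i V →
      ∀ p ∈ V, p ≠ c ∧ ∀ x, x ∈ V ↔ ∃ ζ : ℂ, ζ ^ i = 1 ∧ x = c + (p - c) * ζ := by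
    by_cases h : 0 < i ∧ IsRegularGonVertexSet i V
    · obtain ⟨c, hc⟩ := h.2.exists_center h.1
      exact ⟨c, fun _ _ => hc⟩
    · exact ⟨0, fun h1 h2 => absurd ⟨h1, h2⟩ h⟩
  choose center hcenter using hcenter
  -- Flags: a polygon with a marked vertex and a primitive root of unity of matching order.
  let flags : Finset (Σ _ : ℕ, Σ _ : Finset ℂ, ℂ × ℂ) :=
    (Finset.Icc K S.card).sigma fun i =>
      (S.powerset.filter (fun V => IsRegularGonVertexSet i V)).sigma fun V =>
        V ×ˢ primitiveRoots i ℂ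
  have hcard : ∑ i ∈ Finset.Icc K S.card,
      i * Nat.totient i * (S.powerset.filter (fun V => IsRegularGonVertexSet i V)).card =
      flags.card := by
    rw [Finset.card_sigma]
    refine Finset.sum_congr rfl fun i hi => ?_
    have hi0 : 0 < i := by
      have := (Finset.mem_Icc.1 hi).1
      omega
    rw [Finset.card_sigma, Finset.sum_congr rfl (g := fun _ => i * Nat.totient i), Finset.sum_const,
      smul_eq_mul, mul_comm]
    intro V hV
    rw [Finset.card_product, (Finset.mem_filter.1 hV).2.card_eq hi0, Complex.card_primitiveRoots]
  have hflags {i : ℕ} {V : Finset ℂ} {p u : ℂ} (h : ⟨i, V, p, u⟩ ∈ flags) :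
      4 ≤ i ∧ V ⊆ S ∧ IsPrimitiveRoot u i ∧ p ≠ center i V ∧ ∀ x, x ∈ V ↔
        ∃ ζ : ℂ, ζ ^ i = 1 ∧ x = center i V + (p - center i V) * ζ := by
    simp only [flags, Finset.mem_sigma, Finset.mem_Icc, Finset.mem_filter, Finset.mem_powerset,
      Finset.mem_product] at h
    obtain ⟨⟨hi, -⟩, ⟨hVS, hV⟩, hpV, hu⟩ := h
    have hi4 := hK.trans hi
    exact ⟨hi4, hVS, isPrimitiveRoot_of_mem_primitiveRoots hu, hcenter i V (by omega) hV p hpV⟩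
  have hroot {i : ℕ} {u : ℂ} (hi : 4 ≤ i) (hu : IsPrimitiveRoot u i) :
      u ≠ 0 ∧ ‖u‖ = 1 ∧ u ≠ 1 ∧ u ^ 2 ≠ 1 ∧ u ^ 3 ≠ 1 :=
    ⟨hu.ne_zero (by omega), hu.norm'_eq_one (by omega), hu.ne_one (by omega),
      hu.pow_ne_one_of_pos_of_lt (by omega) (by omega),
      hu.pow_ne_one_of_pos_of_lt (by omega) (by omega)⟩
  rw [hcard]
  refine Finset.card_le_mul_card_image_of_maps_to
    (f := fun x => rotationTriangle (center x.1 x.2.1) x.2.2.1 x.2.2.2) ?_ 2 ?_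
  · rintro ⟨i, V, p, u⟩ h
    obtain ⟨hi, hVS, hu, hp, hV⟩ := hflags h
    obtain ⟨hu0, hnorm, hu1, hu2, -⟩ := hroot hi hu
    dsimp only
    have hpq := apex_ne_rotation hp hu1
    have hpr := apex_ne_rotation hp (inv_ne_one.2 hu1)
    have hqr := rotation_ne_rotation_inv hp hu0 hu2
    refine Finset.mem_filter.2 ⟨Finset.mem_powerset.2 fun x hx => hVS ((hV x).2 ?_),
      Finset.card_eq_three.2 ⟨_, _, _, hpq, hpr, hqr, rfl⟩,
      p, mem_rotationTriangle.2 (.inl rfl), _, mem_rotationTriangle.2 (.inr (.inl rfl)),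
      _, mem_rotationTriangle.2 (.inr (.inr rfl)), hpq, hpr, hqr, ?_⟩
    · rcases mem_rotationTriangle.1 hx with rfl | rfl | rfl
      · exact ⟨1, one_pow _, by ring⟩
      · exact ⟨u, hu.pow_eq_one, rfl⟩
      · exact ⟨u⁻¹, by rw [inv_pow, hu.pow_eq_one, inv_one], rfl⟩
    · set c := center i V
      have h1 : p - (c + (p - c) * u) = -u * (p - (c + (p - c) * u⁻¹)) := by
        field_simp
        ring
      rw [h1, norm_mul, norm_neg, hnorm, one_mul]
  · intro t _
    rcases (flags.filter fun x =>
      rotationTriangle (center x.1 x.2.1) x.2.2.1 x.2.2.2 = t).eq_empty_or_nonempty with he | hne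
    · simp [he]
    obtain ⟨⟨i, V, p, u⟩, hx⟩ := hne
    obtain ⟨hmem, rfl⟩ := Finset.mem_filter.1 hx
    refine (Finset.card_le_card (t := {⟨i, V, p, u⟩, ⟨i, V, p, u⁻¹⟩}) ?_).trans Finset.card_le_two
    rintro ⟨i', V', p', u'⟩ hy
    obtain ⟨hy, hxy⟩ := Finset.mem_filter.1 hy
    dsimp only at hxy
    obtain ⟨hi, -, hu, hp, hV⟩ := hflags hmem
    obtain ⟨hi', -, hu', hp', hV'⟩ := hflags hy
    obtain ⟨hu0, hnorm, hu1, hu2, hu3⟩ := hroot hi hu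
    obtain ⟨-, hnorm', hu1', -, -⟩ := hroot hi' hu'
    have hc := center_eq_of_rotationTriangle_eq hp hnorm hu1 hu2 hnorm' hxy.symm
    rw [← hc] at hp' hV' hxy
    obtain ⟨rfl, huu⟩ := apex_eq_of_rotationTriangle_eq hp hp' hu0 hu1 hu2 hu3 hu1' hxy.symm
    obtain rfl : i' = i := by
      rcases huu with rfl | rfl
      · exact hu'.unique hu
      · exact hu'.unique hu.inv
    obtain rfl : V' = V := by
      ext x
      rw [hV, hV']
    rcases huu with rfl | rfl <;> simp
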